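/- arXiv:2605.03114 — 4 statements merged into one kernel-verified Lean document; each statement's English description precedes it below -/
import Mathlib

section
/- Let C be a monoidal category and let (E, η) be an idempotent pointed object of C. Then the two morphisms λ_E⁻¹ ≫ (η ▷ E) and ρ_E⁻¹ ≫ (E ◁ η) : E ⟶ E ⊗ E are equal, their common inverse μ := (λ_E⁻¹ ≫ (η ▷ E))⁻¹ : E ⊗ E ⟶ E makes (E, η, μ) a monoid object of C (i.e. μ is associative and satisfies the left and right unit laws with respect to η), and this is the unique monoid object structure on E whose unit is η; in particular its multiplication is an isomorphism. -/
open CategoryTheory MonoidalCategory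

/-- The candidate multiplication on an idempotent pointed object: the inverse of
`λ_E⁻¹ ≫ (η ▷ E) : E ⟶ E ⊗ E`. -/
noncomputable def idemMul {C : Type*} [Category C] [MonoidalCategory C]
    (E : C) (η : 𝟙_ C ⟶ E) [IsIso ((λ_ E).inv ≫ η ▷ E)] : E ⊗ E ⟶ E :=
  inv ((λ_ E).inv ≫ η ▷ E)

namespace CategoryTheory.MonoidalCategory

variable {C : Type*} [Category C] [MonoidalCategory C] (E : C) (η : 𝟙_ C ⟶ E)

theorem leftPoint_comp {X : C} (f : E ⟶ X) :
    ((λ_ E).inv ≫ η ▷ E) ≫ E ◁ f = f ≫ (λ_ X).inv ≫ η ▷ X := by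
  rw [Category.assoc, ← whisker_exchange, leftUnitor_inv_naturality_assoc]

theorem rightPoint_comp {X : C} (f : E ⟶ X) :
    ((ρ_ E).inv ≫ E ◁ η) ≫ f ▷ E = f ≫ (ρ_ X).inv ≫ X ◁ η := by
  rw [Category.assoc, whisker_exchange, rightUnitor_inv_naturality_assoc]

theorem leftPoint_whiskerRight (X : C) :
    ((λ_ E).inv ≫ η ▷ E) ▷ X ≫ (α_ E E X).hom = (λ_ (E ⊗ X)).inv ≫ η ▷ (E ⊗ X) := by
  simp

theorem rightPoint_whiskerRight (X : C) :
    ((ρ_ E).inv ≫ E ◁ η) ▷ X ≫ (α_ E E X).hom = E ◁ ((λ_ X).inv ≫ η ▷ X) := by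
  simp

theorem rightPoint_tensor (X : C) :
    ((ρ_ (X ⊗ E)).inv ≫ (X ⊗ E) ◁ η) ≫ (α_ X E E).hom = X ◁ ((ρ_ E).inv ≫ E ◁ η) := by
  simp

theorem leftPoint_whiskerRight_eq_whiskerLeft [IsIso ((λ_ E).inv ≫ η ▷ E)] :
    ((λ_ E).inv ≫ η ▷ E) ▷ E ≫ (α_ E E E).hom = E ◁ ((λ_ E).inv ≫ η ▷ E) := by
  rw [← cancel_epi ((λ_ E).inv ≫ η ▷ E), leftPoint_comp, leftPoint_whiskerRight]

theorem leftPoint_whiskerRight_eq [IsIso ((λ_ E).inv ≫ η ▷ E)] :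
    ((λ_ E).inv ≫ η ▷ E) ▷ E = ((ρ_ E).inv ≫ E ◁ η) ▷ E := by
  rw [← cancel_mono (α_ E E E).hom, leftPoint_whiskerRight_eq_whiskerLeft,
    rightPoint_whiskerRight]

theorem leftPoint_eq_rightPoint
    [IsIso ((λ_ E).inv ≫ η ▷ E)] [IsIso ((ρ_ E).inv ≫ E ◁ η)] :
    (λ_ E).inv ≫ η ▷ E = (ρ_ E).inv ≫ E ◁ η := by
  have h := rightPoint_comp E η ((λ_ E).inv ≫ η ▷ E)
  rw [leftPoint_whiskerRight_eq, rightPoint_comp E η ((ρ_ E).inv ≫ E ◁ η)] at h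
  rw [← cancel_mono (E ◁ ((ρ_ E).inv ≫ E ◁ η)), ← rightPoint_tensor]
  simpa only [Category.assoc] using (h =≫ (α_ E E E).hom).symm

theorem inv_leftPoint_assoc [IsIso ((λ_ E).inv ≫ η ▷ E)] :
    inv ((λ_ E).inv ≫ η ▷ E) ▷ E ≫ inv ((λ_ E).inv ≫ η ▷ E) =
      (α_ E E E).hom ≫ E ◁ inv ((λ_ E).inv ≫ η ▷ E) ≫ inv ((λ_ E).inv ≫ η ▷ E) := by
  rw [← cancel_epi (((λ_ E).inv ≫ η ▷ E) ▷ E),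
    ← Category.assoc (_ ▷ E) (α_ E E E).hom, leftPoint_whiskerRight_eq_whiskerLeft,
    ← comp_whiskerRight_assoc, ← whiskerLeft_comp_assoc, IsIso.hom_inv_id,
    id_whiskerRight, whiskerLeft_id]

end CategoryTheory.MonoidalCategory

/-- An idempotent pointed object of a monoidal category carries a unique monoid object
structure with the given unit; its multiplication is the common inverse of the two
(equal) idempotence isomorphisms, and in particular is an isomorphism. -/
theorem stmt_0 {C : Type*} [Category C] [MonoidalCategory C]
    (E : C) (η : 𝟙_ C ⟶ E)
    [IsIso ((λ_ E).inv ≫ η ▷ E)] [IsIso ((ρ_ E).inv ≫ E ◁ η)] :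
    ((λ_ E).inv ≫ η ▷ E = (ρ_ E).inv ≫ E ◁ η) ∧
    ((η ▷ E) ≫ idemMul E η = (λ_ E).hom ∧
      (E ◁ η) ≫ idemMul E η = (ρ_ E).hom ∧
      (idemMul E η ▷ E) ≫ idemMul E η =
        (α_ E E E).hom ≫ (E ◁ idemMul E η) ≫ idemMul E η) ∧
    (∀ μ : E ⊗ E ⟶ E,
      ((η ▷ E) ≫ μ = (λ_ E).hom ∧ (E ◁ η) ≫ μ = (ρ_ E).hom ∧
        (μ ▷ E) ≫ μ = (α_ E E E).hom ≫ (E ◁ μ) ≫ μ) → μ = idemMul E η) ∧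
    IsIso (idemMul E η) := by
  have h := leftPoint_eq_rightPoint E η
  have left_unit : η ▷ E ≫ idemMul E η = (λ_ E).hom := by
    rw [← cancel_epi (λ_ E).inv, ← Category.assoc, Iso.inv_hom_id]
    exact IsIso.hom_inv_id _
  have right_unit : E ◁ η ≫ idemMul E η = (ρ_ E).hom := by
    rw [← cancel_epi (ρ_ E).inv, ← Category.assoc, ← h, Iso.inv_hom_id]
    exact IsIso.hom_inv_id _
  refine ⟨h, ⟨left_unit, right_unit, inv_leftPoint_assoc E η⟩, ?_, ?_⟩
  · rintro μ ⟨hμ, -, -⟩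
    rw [← cancel_epi ((λ_ E).inv ≫ η ▷ E), Category.assoc, Category.assoc, hμ, left_unit]
  · unfold idemMul
    infer_instance
end

section
/- Let I and J be types and let e : (I →₀ ℕ) ≃+ (J →₀ ℕ) be an isomorphism of additive monoids between the free commutative monoids on I and on J. Then e maps the standard generators to standard generators: there is a bijection σ : I ≃ J such that e (Finsupp.single i 1) = Finsupp.single (σ i) 1 for every i ∈ I. -/
theorem Finsupp.addIrreducible_single_one {I : Type*} (i : I) :
    AddIrreducible (Finsupp.single i 1 : I →₀ ℕ) where
  not_isAddUnit := by simp
  isAddUnit_or_isAddUnit := by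
    intro a b h
    have hdeg := congrArg Finsupp.degree h
    rw [Finsupp.degree_single, map_add] at hdeg
    simp only [isAddUnit_iff_eq_zero, ← Finsupp.degree_eq_zero_iff]
    omega

theorem Finsupp.exists_eq_single_one_of_addIrreducible {I : Type*} {p : I →₀ ℕ}
    (hp : AddIrreducible p) : ∃ i, p = Finsupp.single i 1 := by
  have hp0 : p ≠ 0 := fun h ↦ hp.not_isAddUnit (by simp [h])
  obtain ⟨i, hi⟩ := Finsupp.ne_iff.mp hp0
  have hle : Finsupp.single i 1 ≤ p := by
    rw [Finsupp.single_le_iff]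
    exact Nat.one_le_iff_ne_zero.mpr hi
  refine ⟨i, ?_⟩
  obtain ⟨q, hq⟩ := exists_add_of_le hle
  have hq0 : q = 0 := by simpa using hp.isAddUnit_or_isAddUnit hq
  simpa [hq0] using hq

theorem AddEquiv.exists_map_single_one {I J : Type*} (e : (I →₀ ℕ) ≃+ (J →₀ ℕ)) (i : I) :
    ∃ j, e (Finsupp.single i 1) = Finsupp.single j 1 :=
  Finsupp.exists_eq_single_one_of_addIrreducible
    ((AddEquiv.addIrreducible_iff e).mpr (Finsupp.addIrreducible_single_one i))

/-- Any isomorphism of additive monoids between free commutative monoids (finitely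
supported `ℕ`-valued functions) carries standard generators to standard generators:
it is induced by a bijection of the generating sets. -/
theorem stmt_8 {I J : Type*} (e : (I →₀ ℕ) ≃+ (J →₀ ℕ)) :
    ∃ σ : I ≃ J, ∀ i : I, e (Finsupp.single i 1) = Finsupp.single (σ i) 1 := by
  choose f hf using e.exists_map_single_one
  choose g hg using e.symm.exists_map_single_one
  refine ⟨⟨f, g, fun i ↦ ?_, fun j ↦ ?_⟩, hf⟩
  · apply Finsupp.single_left_injective (one_ne_zero (α := ℕ))
    simp only [← hg, ← hf, e.symm_apply_apply]
  · apply Finsupp.single_left_injective (one_ne_zero (α := ℕ))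
    simp only [← hf, ← hg, e.apply_symm_apply]
end

section
/- Let C be a preadditive category with finite biproducts and let J be a small category all of whose hom-sets are finite. Fix an object i of J. Then the evaluation functor ev_i : (J ⥤ C) ⥤ C admits a right adjoint R given on objects by (R X)(j) = ⨁_{f ∈ Hom_J(j, i)} X, the finite biproduct of copies of X indexed by Hom_J(j, i), with functoriality in j induced by precomposition of indices; moreover R preserves all colimits (for any diagram of shape admitting a colimit in C, R carries its colimit to a colimit in J ⥤ C). -/
open CategoryTheory CategoryTheory.Limits

universe w w' v' u' v u

variable {C : Type u} [Category.{v} C] [Preadditive C] [HasFiniteBiproducts C]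
variable {J : Type u'} [Category.{v'} J] [∀ a b : J, Finite (a ⟶ b)]

/-- The right adjoint to evaluation at `i`: it sends `X : C` to the functor
`j ↦ ⨁_{f ∈ Hom(j, i)} X`, the finite biproduct of copies of `X` indexed by `Hom(j, i)`,
with functoriality in `j` induced by precomposition of indices. -/
noncomputable def evalRightAdjoint (i : J) : C ⥤ J ⥤ C where
  obj X :=
    { obj := fun j => ⨁ (fun (_ : j ⟶ i) => X)
      map := fun {j j'} φ =>
        biproduct.lift fun g : j' ⟶ i => biproduct.π (fun (_ : j ⟶ i) => X) (φ ≫ g) }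
  map {X Y} f :=
    { app := fun j => biproduct.map fun (_ : j ⟶ i) => f }

/-- The homs `X(i) ⟶ Y` correspond to natural transformations `X ⟶ evalRightAdjoint i Y`. -/
noncomputable def evalAdjunction (i : J) :
    (evaluation J C).obj i ⊣ evalRightAdjoint (C := C) i :=
  Adjunction.mkOfHomEquiv
    { homEquiv := fun F X =>
        { toFun := fun f =>
            { app := fun j => biproduct.lift fun g : j ⟶ i => F.map g ≫ f
              naturality := fun j j' φ => by
                apply biproduct.hom_ext
                intro g
                simp [evalRightAdjoint] }
          invFun := fun α => α.app i ≫ biproduct.π (fun _ : i ⟶ i => X) (𝟙 i)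
          left_inv := fun f => (biproduct.lift_π _ _).trans (by simp)
          right_inv := fun α => by
            ext j
            apply biproduct.hom_ext
            intro g
            have h := α.naturality g =≫ biproduct.π (fun _ : i ⟶ i => X) (𝟙 i)
            simp only [evalRightAdjoint, Category.assoc, biproduct.lift_π, Category.comp_id] at h
            exact (biproduct.lift_π _ _).trans h }
      homEquiv_naturality_left_symm := fun _ _ => Category.assoc _ _ _
      homEquiv_naturality_right := fun {F X Y} f g => by
        ext j
        apply biproduct.hom_ext
        intro h
        change biproduct.lift (fun g' : j ⟶ i => F.map g' ≫ f ≫ g) ≫ biproduct.π _ h =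
          (biproduct.lift (fun g' : j ⟶ i => F.map g' ≫ f) ≫ biproduct.map fun _ => g) ≫
            biproduct.π _ h
        simp }

/-- Taking the biproduct of a fixed family of copies preserves colimit cocones. -/
noncomputable def isColimitBiproductCopies (i j : J) {K : Type w'} [Category.{w} K] {F : K ⥤ C}
    {c : Cocone F} (hc : IsColimit c) :
    IsColimit ((evalRightAdjoint (C := C) i ⋙ (evaluation J C).obj j).mapCocone c) where
  desc s := biproduct.desc fun f : j ⟶ i => hc.desc
    { pt := s.pt
      ι :=
        { app := fun k => biproduct.ι (fun _ : j ⟶ i => F.obj k) f ≫ s.ι.app k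
          naturality := fun k k' φ => by
            have h := s.w φ
            dsimp [evalRightAdjoint] at h
            simp [← h] } }
  fac s k := by
    apply biproduct.hom_ext'
    intro f
    simp [evalRightAdjoint]
  uniq s m hm := by
    apply biproduct.hom_ext'
    intro f
    apply hc.hom_ext
    intro k
    simp only [biproduct.ι_desc, IsColimit.fac, ← hm]
    exact (biproduct.ι_map_assoc (fun _ : j ⟶ i => c.ι.app k) f m).symm

/-- In a preadditive category with finite biproducts, for a category `J` with finite
hom-sets, the evaluation functor at `i : J` admits a right adjoint given by
`X ↦ (j ↦ ⨁_{Hom(j,i)} X)`; moreover this right adjoint preserves all colimits. -/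
theorem stmt_10 (i : J) :
    Nonempty ((evaluation J C).obj i ⊣ evalRightAdjoint (C := C) i) ∧
    PreservesColimitsOfSize.{w, w'} (evalRightAdjoint (C := C) i) := by
  exact ⟨⟨evalAdjunction i⟩, ⟨⟨⟨fun hc => ⟨evaluationJointlyReflectsColimits _ fun j =>
    isColimitBiproductCopies i j hc⟩⟩⟩⟩⟩
end

section
/- Let C be a category and, for each n ∈ ℕ, let C_n be a category, G_n : C_{n+1} ⥤ C_n a functor, and R_n : C ⥤ C_n a functor equipped with a natural isomorphism φ_n : R_n ≅ R_{n+1} ⋙ G_n and a left adjoint L_n ⊣ R_n with unit η_n and counit ε_n. Assume that for all objects X, Y of C the canonical map Hom_C(X, Y) ⟶ lim_n Hom_{C_n}(R_n X, R_n Y) is a bijection, where the limit is over the tower whose transition maps apply G_n and conjugate by φ_n. Then for every object X of C: the morphisms c_n : L_n R_n X ⟶ L_{n+1} R_{n+1} X, defined as the adjoint transpose under L_n ⊣ R_n of the composite R_n X ≅ G_n(R_{n+1} X) ⟶ G_n(R_{n+1} L_{n+1} R_{n+1} X) ≅ R_n(L_{n+1} R_{n+1} X) (the middle map being G_n applied to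 the unit η_{n+1} at R_{n+1} X, the outer isomorphisms instances of φ_n), make n ↦ L_n R_n X a sequential diagram in C; the counit components ε_{n,X} : L_n R_n X ⟶ X form a cocone over this diagram; and this cocone is a colimit cocone. -/
open CategoryTheory

universe v u v' u'

/-- The transition map `Lₙ Rₙ X ⟶ Lₙ₊₁ Rₙ₊₁ X` corepresents the transition of hom-sets: the
transpose of its composite with `f` is the conjugate by `e` of `F` applied to the transpose
of `f`. -/
theorem homEquiv_transition_comp {C : Type*} [Category* C] {A B : Type*} [Category* A]
    [Category* B] {F : B ⥤ A} {R : C ⥤ A} {S : C ⥤ B} (e : R ≅ S ⋙ F)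
    {L : A ⥤ C} {M : B ⥤ C} (adj : L ⊣ R) (adj' : M ⊣ S) {X Y : C}
    (f : M.obj (S.obj X) ⟶ Y) :
    adj.homEquiv _ _ ((adj.homEquiv _ _).symm
      (e.hom.app X ≫ F.map (adj'.unit.app (S.obj X)) ≫
        e.inv.app (M.obj (S.obj X))) ≫ f) =
      e.hom.app X ≫ F.map (adj'.homEquiv _ _ f) ≫ e.inv.app Y := by
  rw [adj.homEquiv_naturality_right, Equiv.apply_symm_apply, adj'.homEquiv_unit]
  have h := e.inv.naturality f
  simp only [Functor.comp_map] at h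
  simp [← h]

/-- The transpose of `ε_X ≫ g` is the image of `g` under the right adjoint. -/
theorem homEquiv_counit_comp {C : Type*} [Category* C] {A : Type*} [Category* A]
    {L : A ⥤ C} {R : C ⥤ A} (adj : L ⊣ R) {X Y : C} (g : X ⟶ Y) :
    adj.homEquiv _ _ (adj.counit.app X ≫ g) = R.map g := by
  simp [adj.homEquiv_unit]

/-- Let `C` be a category and, for each `n : ℕ`, let `D n` be a category,
`G n : D (n+1) ⥤ D n` a functor and `R n : C ⥤ D n` a functor equipped with a natural
isomorphism `φ n : R n ≅ R (n+1) ⋙ G n` and a left adjoint `L n ⊣ R n`.  If for all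
`X Y : C` the canonical map from `Hom(X, Y)` to the limit of the tower of hom-sets
`Hom(Rₙ X, Rₙ Y)` (with transitions given by applying `G n` and conjugating by `φ n`)
is a bijection, then for every `X : C` the adjoint transposes
`cₙ : Lₙ Rₙ X ⟶ Lₙ₊₁ Rₙ₊₁ X` of the composites
`Rₙ X ≅ Gₙ (Rₙ₊₁ X) ⟶ Gₙ (Rₙ₊₁ Lₙ₊₁ Rₙ₊₁ X) ≅ Rₙ (Lₙ₊₁ Rₙ₊₁ X)` make `n ↦ Lₙ Rₙ X` a
sequential diagram, the counit components `Lₙ Rₙ X ⟶ X` form a cocone over it, and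
this cocone is a colimit cocone (every compatible family of maps to `Y` factors
uniquely through the counits). -/
theorem stmt_11 {C : Type u} [Category.{v} C]
    {D : ℕ → Type u'} [∀ n, Category.{v'} (D n)]
    (G : ∀ n, D (n + 1) ⥤ D n)
    (R : ∀ n, C ⥤ D n)
    (φ : ∀ n, R n ≅ R (n + 1) ⋙ G n)
    (L : ∀ n, D n ⥤ C)
    (adj : ∀ n, L n ⊣ R n)
    (h_inj : ∀ (X Y : C) (f g : X ⟶ Y), (∀ n, (R n).map f = (R n).map g) → f = g)
    (h_surj : ∀ (X Y : C) (s : ∀ n, (R n).obj X ⟶ (R n).obj Y),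
      (∀ n, s n = (φ n).hom.app X ≫ (G n).map (s (n + 1)) ≫ (φ n).inv.app Y) →
      ∃ f : X ⟶ Y, ∀ n, (R n).map f = s n)
    (X : C) :
    letI c : ∀ n, (L n).obj ((R n).obj X) ⟶ (L (n + 1)).obj ((R (n + 1)).obj X) :=
      fun n => ((adj n).homEquiv _ _).symm
        ((φ n).hom.app X ≫
          (G n).map ((adj (n + 1)).unit.app ((R (n + 1)).obj X)) ≫
          (φ n).inv.app ((L (n + 1)).obj ((R (n + 1)).obj X)))
    (∀ n, c n ≫ (adj (n + 1)).counit.app X = (adj n).counit.app X) ∧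
    (∀ (Y : C) (t : ∀ n, (L n).obj ((R n).obj X) ⟶ Y),
      (∀ n, c n ≫ t (n + 1) = t n) →
      ∃! g : X ⟶ Y, ∀ n, (adj n).counit.app X ≫ g = t n) := by
  refine ⟨fun n => ?_, fun Y t ht => ?_⟩
  · apply ((adj n).homEquiv _ _).injective
    rw [homEquiv_transition_comp]
    simp [Adjunction.homEquiv_unit]
  · obtain ⟨g, hg⟩ := h_surj X Y (fun n => (adj n).homEquiv _ _ (t n)) fun n => by
      rw [← homEquiv_transition_comp (φ n) (adj n) (adj (n + 1)), ht n]
    refine ⟨g, fun n => ?_, fun g' hg' => h_inj X Y _ _ fun n => ?_⟩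
    · apply ((adj n).homEquiv _ _).injective
      rw [homEquiv_counit_comp, hg]
    · rw [hg, ← hg' n, homEquiv_counit_comp]
end
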